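/- arXiv:0812.1351 — 2 statements merged into one kernel-verified Lean document; each statement's English description precedes it below -/
import Mathlib

section
/- Let F : ℝ³ → ℝ be smooth and let D ⊆ ℝ³ be an open set on which F ≠ 0, F_{u₁} ≠ 0, F_{u₁u₁} ≠ 0 and u₁·F_{u₁} − F ≠ 0. Then on D the Lie bracket of the vector fields ∇₂^F and ∇₁^F satisfies the commutation relation [∇₂^F, ∇₁^F] = J^F · ∇₁^F, where J^F = F²·F_{u₁u₁} / ((u₁·F_{u₁} − F)·F_{u₁}²). -/
noncomputable section

/-- Directional (partial) derivative of a function on `ℝ³ = ℝ × ℝ × ℝ`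
(coordinates `(x, u, u₁)`) in the direction `v`. -/
def pd (H : ℝ × ℝ × ℝ → ℝ) (v : ℝ × ℝ × ℝ) : ℝ × ℝ × ℝ → ℝ :=
  fun p => fderiv ℝ H p v

/-- The coordinate direction `∂/∂x`. -/
def dx : ℝ × ℝ × ℝ := (1, 0, 0)

/-- The coordinate direction `∂/∂u`. -/
def du : ℝ × ℝ × ℝ := (0, 1, 0)

/-- The coordinate direction `∂/∂u₁`. -/
def du1 : ℝ × ℝ × ℝ := (0, 0, 1)

/-- `U_x`, the partial derivative of `U(x,u)` in the first variable. -/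
def Ux (U : ℝ × ℝ → ℝ) : ℝ × ℝ → ℝ := fun q => fderiv ℝ U q (1, 0)

/-- `U_u`, the partial derivative of `U(x,u)` in the second variable. -/
def Uu (U : ℝ × ℝ → ℝ) : ℝ × ℝ → ℝ := fun q => fderiv ℝ U q (0, 1)

/-- The feedback transformation `(X, U)` relates `G` to `F` on `D`:
`X'(x)·G(x,u,u₁) = F(X x, U (x,u), U_x·G + U_u·u₁)` for all `(x,u,u₁) ∈ D`. -/
def Relates (X : ℝ → ℝ) (U : ℝ × ℝ → ℝ) (G F : ℝ × ℝ × ℝ → ℝ) (D : Set (ℝ × ℝ × ℝ)) : Prop :=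
  ∀ p ∈ D, deriv X p.1 * G p =
    F (X p.1, U (p.1, p.2.1), Ux U (p.1, p.2.1) * G p + Uu U (p.1, p.2.1) * p.2.2)

/-- The prolongation `Φ̃(x,u,u₁) = (X x, U (x,u), U_x·G + U_u·u₁)`. -/
def Prol (X : ℝ → ℝ) (U : ℝ × ℝ → ℝ) (G : ℝ × ℝ × ℝ → ℝ) : ℝ × ℝ × ℝ → ℝ × ℝ × ℝ :=
  fun p => (X p.1, U (p.1, p.2.1), Ux U (p.1, p.2.1) * G p + Uu U (p.1, p.2.1) * p.2.2)

/-- `W(x,u,u₁) = U_x(x,u)·G_{u₁}(x,u,u₁) + U_u(x,u)`. -/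
def Wfun (U : ℝ × ℝ → ℝ) (G : ℝ × ℝ × ℝ → ℝ) : ℝ × ℝ × ℝ → ℝ :=
  fun p => Ux U (p.1, p.2.1) * pd G du1 p + Uu U (p.1, p.2.1)

/-- The basic second-order feedback differential invariant
`J^H = H²·H_{u₁u₁} / ((u₁·H_{u₁} − H)·H_{u₁}²)`. -/
def Jinv (H : ℝ × ℝ × ℝ → ℝ) : ℝ × ℝ × ℝ → ℝ :=
  fun p => H p ^ 2 * pd (pd H du1) du1 p / ((p.2.2 * pd H du1 p - H p) * pd H du1 p ^ 2)

/-- The feedback invariant derivation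
`∇₁^H = (0, (u₁·H_{u₁} − H)/H_{u₁}, (H − u₁·H_{u₁})·H_u/H_{u₁}²)`. -/
def nabla1 (H : ℝ × ℝ × ℝ → ℝ) : ℝ × ℝ × ℝ → ℝ × ℝ × ℝ := fun p =>
  (0, (p.2.2 * pd H du1 p - H p) / pd H du1 p,
    (H p - p.2.2 * pd H du1 p) * pd H du p / pd H du1 p ^ 2)

/-- The feedback invariant derivation `∇₂^H = (0, 0, H/H_{u₁})`. -/
def nabla2 (H : ℝ × ℝ × ℝ → ℝ) : ℝ × ℝ × ℝ → ℝ × ℝ × ℝ := fun p =>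
  (0, 0, H p / pd H du1 p)

/-- The feedback invariant derivation
`∇₃^H = (H, H/H_{u₁}, (H_x H_{u₁} + H_u − u₁ H_{uu₁} − H_{xu₁})/H_{u₁u₁}
          + ((u₁ H_{u₁} − H)/H_{u₁}²)·H_u)`. -/
def nabla3 (H : ℝ × ℝ × ℝ → ℝ) : ℝ × ℝ × ℝ → ℝ × ℝ × ℝ := fun p =>
  (H p, H p / pd H du1 p,
    (pd H dx p * pd H du1 p + pd H du p - p.2.2 * pd (pd H du) du1 p - pd (pd H dx) du1 p)
        / pd (pd H du1) du1 p
      + ((p.2.2 * pd H du1 p - H p) / pd H du1 p ^ 2) * pd H du p)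

/-- Lie bracket of vector fields on (an open subset of) `ℝ³`:
`[V,W](p) = DW(p)·V(p) − DV(p)·W(p)`. -/
def lie (V W : ℝ × ℝ × ℝ → ℝ × ℝ × ℝ) : ℝ × ℝ × ℝ → ℝ × ℝ × ℝ :=
  fun p => fderiv ℝ W p (V p) - fderiv ℝ V p (W p)

lemma differentiable_pd {H : ℝ × ℝ × ℝ → ℝ} (hH : ContDiff ℝ (⊤ : ℕ∞) H) (v : ℝ × ℝ × ℝ) :
    Differentiable ℝ (pd H v) :=
  ((hH.fderiv_right (m := 1) (by decide)).clm_apply contDiff_const).differentiable one_ne_zero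

lemma pd_comm {H : ℝ × ℝ × ℝ → ℝ} (hH : ContDiff ℝ (⊤ : ℕ∞) H) (v w p : ℝ × ℝ × ℝ) :
    pd (pd H v) w p = pd (pd H w) v p := by
  have hd : DifferentiableAt ℝ (fderiv ℝ H) p :=
    (hH.fderiv_right (m := 1) (by decide)).differentiable one_ne_zero p
  have key (a b : ℝ × ℝ × ℝ) : pd (pd H a) b p = fderiv ℝ (fderiv ℝ H) p b a := by
    change fderiv ℝ (fun q => fderiv ℝ H q a) p b = _
    rw [fderiv_clm_apply hd (differentiableAt_const a)]
    simp
  rw [key, key]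
  exact hH.contDiffAt.isSymmSndFDerivAt (by simp; decide) w v

/-- The differential of a function on `ℝ³` in the directions spanned by `∂/∂u` and `∂/∂u₁`. -/
lemma fderiv_apply_vertical (H : ℝ × ℝ × ℝ → ℝ) (p : ℝ × ℝ × ℝ) (b c : ℝ) :
    fderiv ℝ H p (0, b, c) = b * pd H du p + c * pd H du1 p := by
  have h : ((0, b, c) : ℝ × ℝ × ℝ) = b • du + c • du1 := by simp [du, du1]
  rw [h, map_add, map_smul, map_smul, smul_eq_mul, smul_eq_mul, pd, pd]

lemma hasDerivAt_line {E : Type*} [NormedAddCommGroup E] [NormedSpace ℝ E]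
    {f : ℝ × ℝ × ℝ → E} {p : ℝ × ℝ × ℝ} (hf : DifferentiableAt ℝ f p) (v : ℝ × ℝ × ℝ) :
    HasDerivAt (fun t : ℝ => f (p + t • v)) (fderiv ℝ f p v) 0 :=
  hf.hasFDerivAt.hasLineDerivAt v

/-- on an open set where `F ≠ 0`, `F_{u₁} ≠ 0`, `F_{u₁u₁} ≠ 0` and
`u₁·F_{u₁} − F ≠ 0`, the commutation relation `[∇₂^F, ∇₁^F] = J^F·∇₁^F` holds,
with `J^F = F²·F_{u₁u₁}/((u₁·F_{u₁} − F)·F_{u₁}²)`. -/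
theorem commutator_nabla2_nabla1
    (F : ℝ × ℝ × ℝ → ℝ) (hF : ContDiff ℝ (⊤ : ℕ∞) F)
    (D : Set (ℝ × ℝ × ℝ)) (hD : IsOpen D)
    (h0 : ∀ p ∈ D, F p ≠ 0)
    (h1 : ∀ p ∈ D, pd F du1 p ≠ 0)
    (h2 : ∀ p ∈ D, pd (pd F du1) du1 p ≠ 0)
    (h3 : ∀ p ∈ D, p.2.2 * pd F du1 p - F p ≠ 0) :
    ∀ p ∈ D, lie (nabla2 F) (nabla1 F) p = Jinv F p • nabla1 F p := by
  intro p hp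
  have hP := h1 p hp
  have hN := h3 p hp
  have dF : DifferentiableAt ℝ F p := hF.differentiable (by simp) p
  have dP := differentiable_pd hF du1 p
  have dQ := differentiable_pd hF du p
  have dz : DifferentiableAt ℝ (fun q : ℝ × ℝ × ℝ => q.2.2) p := by fun_prop
  have dW : DifferentiableAt ℝ (nabla1 F) p := by
    unfold nabla1
    fun_prop (disch := simp [hP])
  have dV : DifferentiableAt ℝ (nabla2 F) p := by
    unfold nabla2
    fun_prop (disch := simp [hP])
  have eW (v : ℝ × ℝ × ℝ) := by
    have hz := hasDerivAt_line dz v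
    have hf := hasDerivAt_line dF v
    have hq := hasDerivAt_line dQ v
    have hp1 := hasDerivAt_line dP v
    have hP' : pd F du1 (p + (0 : ℝ) • v) ≠ 0 := by simpa using hP
    exact (hasDerivAt_line dW v).unique
      ((hasDerivAt_const 0 0).prodMk ((((hz.fun_mul hp1).fun_sub hf).fun_div hp1 hP').prodMk
        (((hf.fun_sub (hz.fun_mul hp1)).fun_mul hq).fun_div (hp1.fun_pow 2) (pow_ne_zero 2 hP'))))
  have eV (v : ℝ × ℝ × ℝ) := by
    have hf := hasDerivAt_line dF v
    have hp1 := hasDerivAt_line dP v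
    have hP' : pd F du1 (p + (0 : ℝ) • v) ≠ 0 := by simpa using hP
    exact (hasDerivAt_line dV v).unique
      ((hasDerivAt_const 0 0).prodMk ((hasDerivAt_const 0 0).prodMk (hf.fun_div hp1 hP')))
  have ez (v : ℝ × ℝ × ℝ) : fderiv ℝ (fun q : ℝ × ℝ × ℝ => q.2.2) p v = v.2.2 :=
    congrArg (fun L : ℝ × ℝ × ℝ →L[ℝ] ℝ => L v)
      (((ContinuousLinearMap.snd ℝ ℝ ℝ).comp (ContinuousLinearMap.snd ℝ ℝ (ℝ × ℝ))).fderiv)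
  rw [lie, eW, eV]
  simp only [zero_smul, add_zero, ez]
  simp only [nabla1, nabla2, Jinv, fderiv_apply_vertical, pd_comm hF du du1]
  refine Prod.ext (by simp) (Prod.ext ?_ ?_)
  · simp
    field_simp
    ring
  · simp
    field_simp
    ring
end
end

section
/- Let F, G : ℝ³ → ℝ be smooth, let D_G ⊆ ℝ³ be open, and suppose the feedback transformation (X,U) relates G to F on D_G, with W ≠ 0 on D_G, and with G ≠ 0, G_{u₁} ≠ 0, G_{u₁u₁} ≠ 0 on D_G and F ≠ 0, F_{u₁} ≠ 0, F_{u₁u₁} ≠ 0 on an open set D_F containing Φ̃(D_G). Suppose K_F : D_F → ℝ and K_G : D_G → ℝ are smooth functions satisfying the commutation relations [∇₃^F, ∇₁^F] = K_F·∇₂^F on D_F and [∇₃^G, ∇₁^G] = K_G·∇₂^G on D_G. Then K_F(Φ̃(p)) = K_G(p) for all p ∈ D_G. That is, the third-order invariant K appearing in the commutation relation is a feedback differential invariant. -/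
noncomputable section

lemma fderiv_eq_pd (H : ℝ × ℝ × ℝ → ℝ) (p w : ℝ × ℝ × ℝ) :
    fderiv ℝ H p w = w.1 * pd H dx p + w.2.1 * pd H du p + w.2.2 * pd H du1 p := by
  have hw : w = w.1 • dx + w.2.1 • du + w.2.2 • du1 := by
    ext <;> simp [dx, du, du1]
  conv_lhs => rw [hw]
  simp [pd]

lemma fderiv_eq_Ux_Uu (f : ℝ × ℝ → ℝ) (q w : ℝ × ℝ) :
    fderiv ℝ f q w = w.1 * Ux f q + w.2 * Uu f q := by
  have hw : w = w.1 • ((1, 0) : ℝ × ℝ) + w.2 • ((0, 1) : ℝ × ℝ) := by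
    ext <;> simp
  conv_lhs => rw [hw, map_add, map_smul, map_smul]
  rfl

lemma two_le_smooth : (2 : WithTop ℕ∞) ≤ ((⊤ : ℕ∞) : WithTop ℕ∞) :=
  WithTop.coe_le_coe.2 le_top

section Smooth

variable {E : Type*} [NormedAddCommGroup E] [NormedSpace ℝ E]

lemma contDiff_fderiv_apply_const {f : E → ℝ} (hf : ContDiff ℝ (⊤ : ℕ∞) f) (v : E) :
    ContDiff ℝ (⊤ : ℕ∞) (fun p => fderiv ℝ f p v) :=
  (hf.fderiv_right (m := (⊤ : ℕ∞)) le_rfl).clm_apply contDiff_const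

lemma fderiv_fderiv_comm {f : E → ℝ} (hf : ContDiff ℝ (⊤ : ℕ∞) f) (v w p : E) :
    fderiv ℝ (fun q => fderiv ℝ f q v) p w = fderiv ℝ (fun q => fderiv ℝ f q w) p v := by
  have hd : DifferentiableAt ℝ (fderiv ℝ f) p :=
    ((hf.fderiv_right (m := (⊤ : ℕ∞)) le_rfl).differentiable (by simp)) p
  have key (a b : E) : fderiv ℝ (fun q => fderiv ℝ f q a) p b = fderiv ℝ (fderiv ℝ f) p b a := by
    rw [fderiv_clm_apply hd (differentiableAt_const a)]
    simp
  rw [key, key]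
  exact (hf.contDiffAt.isSymmSndFDerivAt (by simpa using two_le_smooth)) w v

end Smooth

lemma contDiff_pd {H : ℝ × ℝ × ℝ → ℝ} (hH : ContDiff ℝ (⊤ : ℕ∞) H) (v : ℝ × ℝ × ℝ) :
    ContDiff ℝ (⊤ : ℕ∞) (pd H v) :=
  contDiff_fderiv_apply_const hH v

lemma differentiableAt_pd {H : ℝ × ℝ × ℝ → ℝ} (hH : ContDiff ℝ (⊤ : ℕ∞) H)
    (v p : ℝ × ℝ × ℝ) : DifferentiableAt ℝ (pd H v) p :=
  (contDiff_pd hH v).differentiable (by simp) p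

lemma differentiableAt_pd_pd {H : ℝ × ℝ × ℝ → ℝ} (hH : ContDiff ℝ (⊤ : ℕ∞) H)
    (v w p : ℝ × ℝ × ℝ) : DifferentiableAt ℝ (pd (pd H v) w) p :=
  differentiableAt_pd (contDiff_pd hH v) w p

lemma differentiableAt_nabla1 {H : ℝ × ℝ × ℝ → ℝ} (hH : ContDiff ℝ (⊤ : ℕ∞) H)
    {p : ℝ × ℝ × ℝ} (h1 : pd H du1 p ≠ 0) : DifferentiableAt ℝ (nabla1 H) p := by
  have d0 : DifferentiableAt ℝ H p := hH.differentiable (by simp) p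
  have d1 := differentiableAt_pd hH du1 p
  have du' := differentiableAt_pd hH du p
  have h2 : pd H du1 p ^ 2 ≠ 0 := pow_ne_zero 2 h1
  unfold nabla1
  fun_prop (disch := assumption)

lemma differentiableAt_nabla3 {H : ℝ × ℝ × ℝ → ℝ} (hH : ContDiff ℝ (⊤ : ℕ∞) H)
    {p : ℝ × ℝ × ℝ} (h1 : pd H du1 p ≠ 0) (h11 : pd (pd H du1) du1 p ≠ 0) :
    DifferentiableAt ℝ (nabla3 H) p := by
  have d0 : DifferentiableAt ℝ H p := hH.differentiable (by simp) p
  have d1 := differentiableAt_pd hH du1 p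
  have du' := differentiableAt_pd hH du p
  have dx' := differentiableAt_pd hH dx p
  have d11 := differentiableAt_pd_pd hH du1 du1 p
  have du1' := differentiableAt_pd_pd hH du du1 p
  have dx1' := differentiableAt_pd_pd hH dx du1 p
  have h2 : pd H du1 p ^ 2 ≠ 0 := pow_ne_zero 2 h1
  unfold nabla3
  fun_prop (disch := assumption)

lemma fderiv_snd_fst {V : ℝ × ℝ × ℝ → ℝ × ℝ × ℝ} {p : ℝ × ℝ × ℝ}
    (hV : DifferentiableAt ℝ V p) (w : ℝ × ℝ × ℝ) :
    (fderiv ℝ V p w).2.1 = fderiv ℝ (fun q => (V q).2.1) p w := by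
  rw [hV.hasFDerivAt.snd.fst.fderiv]
  simp

lemma fderiv_fun_div_apply {E : Type*} [NormedAddCommGroup E] [NormedSpace ℝ E] {f g : E → ℝ}
    {p : E} (hf : DifferentiableAt ℝ f p) (hg : DifferentiableAt ℝ g p) (h : g p ≠ 0) (w : E) :
    fderiv ℝ (fun q => f q / g q) p w =
      (fderiv ℝ f p w * g p - f p * fderiv ℝ g p w) / g p ^ 2 := by
  have hi : HasFDerivAt (fun q => (g q)⁻¹) _ p :=
    (hasDerivAt_inv h).comp_hasFDerivAt p hg.hasFDerivAt
  simp_rw [div_eq_mul_inv (f _)]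
  rw [(hf.hasFDerivAt.fun_mul hi).fderiv]
  simp
  field_simp
  ring

/-- The middle component of `[∇₃, ∇₁]`, the obstruction to being a multiple of `∇₂`. -/
lemma lie_nabla3_nabla1_snd_fst {H : ℝ × ℝ × ℝ → ℝ} (hH : ContDiff ℝ (⊤ : ℕ∞) H)
    {p : ℝ × ℝ × ℝ} (h1 : pd H du1 p ≠ 0) (h11 : pd (pd H du1) du1 p ≠ 0) :
    (lie (nabla3 H) (nabla1 H) p).2.1 =
      H p / pd H du1 p ^ 2 * ((H p - 1) * pd (pd H dx) du1 p) := by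
  have d0 : DifferentiableAt ℝ H p := hH.differentiable (by simp) p
  have d1 := differentiableAt_pd hH du1 p
  have dv : HasFDerivAt (fun q : ℝ × ℝ × ℝ => q.2.2)
      ((ContinuousLinearMap.snd ℝ ℝ ℝ).comp (ContinuousLinearMap.snd ℝ ℝ (ℝ × ℝ))) p :=
    hasFDerivAt_snd.comp p hasFDerivAt_snd
  have dn : HasFDerivAt (fun q => q.2.2 * pd H du1 q - H q) _ p :=
    (dv.fun_mul d1.hasFDerivAt).fun_sub d0.hasFDerivAt
  have e1 : fderiv ℝ (fun q => (nabla1 H q).2.1) p (nabla3 H p) = _ :=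
    fderiv_fun_div_apply dn.differentiableAt d1 h1 _
  have e3 : fderiv ℝ (fun q => (nabla3 H q).2.1) p (nabla1 H p) = _ :=
    fderiv_fun_div_apply d0 d1 h1 _
  unfold lie
  rw [Prod.snd_sub, Prod.fst_sub, fderiv_snd_fst (differentiableAt_nabla1 hH h1),
    fderiv_snd_fst (differentiableAt_nabla3 hH h1 h11), e1, e3, dn.fderiv]
  simp only [add_apply, sub_apply,
    smul_apply, smul_eq_mul, fderiv_eq_pd H, fderiv_eq_pd (pd H du1),
    ContinuousLinearMap.comp_apply, ContinuousLinearMap.coe_snd',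
    pd_comm hH du1 dx, pd_comm hH du1 du, nabla1, nabla3]
  field_simp
  ring

lemma fderiv_lie_of_related {Φ V W V' W' : ℝ × ℝ × ℝ → ℝ × ℝ × ℝ} {p : ℝ × ℝ × ℝ}
    (hΦ : ContDiff ℝ (⊤ : ℕ∞) Φ)
    (hV : DifferentiableAt ℝ V p) (hW : DifferentiableAt ℝ W p)
    (hV' : DifferentiableAt ℝ V' (Φ p)) (hW' : DifferentiableAt ℝ W' (Φ p))
    (rV : ∀ᶠ q in nhds p, fderiv ℝ Φ q (V q) = V' (Φ q))
    (rW : ∀ᶠ q in nhds p, fderiv ℝ Φ q (W q) = W' (Φ q)) :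
    fderiv ℝ Φ p (lie V W p) = lie V' W' (Φ p) := by
  have hd : DifferentiableAt ℝ (fderiv ℝ Φ) p :=
    ((hΦ.fderiv_right (m := (⊤ : ℕ∞)) le_rfl).differentiable (by simp)) p
  have dΦ : DifferentiableAt ℝ Φ p := hΦ.differentiable (by simp) p
  have key {A A' : ℝ × ℝ × ℝ → ℝ × ℝ × ℝ} (hA : DifferentiableAt ℝ A p)
      (hA' : DifferentiableAt ℝ A' (Φ p))
      (rA : ∀ᶠ q in nhds p, fderiv ℝ Φ q (A q) = A' (Φ q)) (w : ℝ × ℝ × ℝ) :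
      fderiv ℝ Φ p (fderiv ℝ A p w) + fderiv ℝ (fderiv ℝ Φ) p w (A p) =
        fderiv ℝ A' (Φ p) (fderiv ℝ Φ p w) := by
    have h := congrArg (fun L : ℝ × ℝ × ℝ →L[ℝ] ℝ × ℝ × ℝ => L w) (Filter.EventuallyEq.fderiv_eq rA)
    have hc : fderiv ℝ (fun q => A' (Φ q)) p = _ := fderiv_comp p hA' dΦ
    rw [hc, fderiv_clm_apply hd hA] at h
    simpa using h
  have kV := key hV hV' rV (W p)
  have kW := key hW hW' rW (V p)
  have hs := (hΦ.contDiffAt (x := p)).isSymmSndFDerivAt (by simpa using two_le_smooth)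
  rw [rW.self_of_nhds] at kV
  rw [rV.self_of_nhds] at kW
  unfold lie
  rw [map_sub, ← kV, ← kW, hs (V p) (W p)]
  abel

section Prolongation

variable {X : ℝ → ℝ} {U : ℝ × ℝ → ℝ} {G F : ℝ × ℝ × ℝ → ℝ}

lemma contDiff_Ux (hU : ContDiff ℝ (⊤ : ℕ∞) U) : ContDiff ℝ (⊤ : ℕ∞) (Ux U) :=
  contDiff_fderiv_apply_const hU _

lemma contDiff_Uu (hU : ContDiff ℝ (⊤ : ℕ∞) U) : ContDiff ℝ (⊤ : ℕ∞) (Uu U) :=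
  contDiff_fderiv_apply_const hU _

lemma Ux_Uu_comm (hU : ContDiff ℝ (⊤ : ℕ∞) U) (q : ℝ × ℝ) : Ux (Uu U) q = Uu (Ux U) q :=
  fderiv_fderiv_comm hU _ _ q

lemma contDiff_Prol (hX : ContDiff ℝ (⊤ : ℕ∞) X) (hU : ContDiff ℝ (⊤ : ℕ∞) U)
    (hG : ContDiff ℝ (⊤ : ℕ∞) G) : ContDiff ℝ (⊤ : ℕ∞) (Prol X U G) := by
  have h1 := contDiff_Ux hU
  have h2 := contDiff_Uu hU
  unfold Prol
  fun_prop

lemma hasFDerivAt_comp_base {f : ℝ × ℝ → ℝ} (hf : ContDiff ℝ (⊤ : ℕ∞) f) (p : ℝ × ℝ × ℝ) :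
    HasFDerivAt (fun q : ℝ × ℝ × ℝ => f (q.1, q.2.1))
      ((fderiv ℝ f (p.1, p.2.1)).comp
        ((ContinuousLinearMap.fst ℝ ℝ (ℝ × ℝ)).prod
          ((ContinuousLinearMap.fst ℝ ℝ ℝ).comp (ContinuousLinearMap.snd ℝ ℝ (ℝ × ℝ))))) p :=
  HasFDerivAt.comp (f := fun q : ℝ × ℝ × ℝ => (q.1, q.2.1)) p
    (hf.differentiable (by simp) _).hasFDerivAt
    (hasFDerivAt_fst.prodMk (hasFDerivAt_fst.comp p hasFDerivAt_snd))

lemma hasFDerivAt_comp_fst {f : ℝ → ℝ} (hf : ContDiff ℝ (⊤ : ℕ∞) f) (p : ℝ × ℝ × ℝ) :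
    HasFDerivAt (fun q : ℝ × ℝ × ℝ => f q.1)
      (deriv f p.1 • ContinuousLinearMap.fst ℝ ℝ (ℝ × ℝ)) p :=
  HasDerivAt.comp_hasFDerivAt (f := fun q : ℝ × ℝ × ℝ => q.1) p
    (hf.differentiable (by simp) _).hasDerivAt hasFDerivAt_fst

lemma fderiv_Prol (hX : ContDiff ℝ (⊤ : ℕ∞) X) (hU : ContDiff ℝ (⊤ : ℕ∞) U)
    (hG : ContDiff ℝ (⊤ : ℕ∞) G) (p w : ℝ × ℝ × ℝ) :
    fderiv ℝ (Prol X U G) p w =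
      (deriv X p.1 * w.1,
        w.1 * Ux U (p.1, p.2.1) + w.2.1 * Uu U (p.1, p.2.1),
        Ux U (p.1, p.2.1) * (w.1 * pd G dx p + w.2.1 * pd G du p + w.2.2 * pd G du1 p)
          + (w.1 * Ux (Ux U) (p.1, p.2.1) + w.2.1 * Uu (Ux U) (p.1, p.2.1)) * G p
          + Uu U (p.1, p.2.1) * w.2.2
          + (w.1 * Uu (Ux U) (p.1, p.2.1) + w.2.1 * Uu (Uu U) (p.1, p.2.1)) * p.2.2) := by
  have d0 : HasFDerivAt G _ p := (hG.differentiable (by simp) p).hasFDerivAt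
  have dv : HasFDerivAt (fun q : ℝ × ℝ × ℝ => q.2.2)
      ((ContinuousLinearMap.snd ℝ ℝ ℝ).comp (ContinuousLinearMap.snd ℝ ℝ (ℝ × ℝ))) p :=
    hasFDerivAt_snd.comp p hasFDerivAt_snd
  have h := (hasFDerivAt_comp_fst hX p).prodMk ((hasFDerivAt_comp_base hU p).prodMk
    (((hasFDerivAt_comp_base (contDiff_Ux hU) p).fun_mul d0).fun_add
      ((hasFDerivAt_comp_base (contDiff_Uu hU) p).fun_mul dv)))
  have h' : fderiv ℝ (Prol X U G) p = _ := h.fderiv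
  rw [h']
  ext
  · simp
  · simp [fderiv_eq_Ux_Uu]
  · simp [fderiv_eq_Ux_Uu, fderiv_eq_pd, Ux_Uu_comm hU]
    ring

lemma fderiv_Wfun (hU : ContDiff ℝ (⊤ : ℕ∞) U)
    (hG : ContDiff ℝ (⊤ : ℕ∞) G) (p w : ℝ × ℝ × ℝ) :
    fderiv ℝ (Wfun U G) p w =
      Ux U (p.1, p.2.1) * (w.1 * pd (pd G du1) dx p + w.2.1 * pd (pd G du1) du p
          + w.2.2 * pd (pd G du1) du1 p)
        + (w.1 * Ux (Ux U) (p.1, p.2.1) + w.2.1 * Uu (Ux U) (p.1, p.2.1)) * pd G du1 p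
        + (w.1 * Uu (Ux U) (p.1, p.2.1) + w.2.1 * Uu (Uu U) (p.1, p.2.1)) := by
  have d1 : HasFDerivAt (pd G du1) _ p := (differentiableAt_pd hG du1 p).hasFDerivAt
  have h : fderiv ℝ (Wfun U G) p = _ :=
    (((hasFDerivAt_comp_base (contDiff_Ux hU) p).fun_mul d1).fun_add
      (hasFDerivAt_comp_base (contDiff_Uu hU) p)).fderiv
  rw [h]
  simp [fderiv_eq_Ux_Uu, fderiv_eq_pd, Ux_Uu_comm hU]
  ring

/-- If `X'·A = (B ∘ Φ̃)·C` near `p`, then the derivatives of both sides agree. -/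
lemma fderiv_of_eventually_rel {A B C : ℝ × ℝ × ℝ → ℝ} {Φ : ℝ × ℝ × ℝ → ℝ × ℝ × ℝ}
    (hX : ContDiff ℝ (⊤ : ℕ∞) X) {p : ℝ × ℝ × ℝ}
    (hA : DifferentiableAt ℝ A p) (hB : DifferentiableAt ℝ B (Φ p))
    (hC : DifferentiableAt ℝ C p) (hΦ : DifferentiableAt ℝ Φ p)
    (h : ∀ᶠ q in nhds p, deriv X q.1 * A q = B (Φ q) * C q) (w : ℝ × ℝ × ℝ) :
    deriv X p.1 * fderiv ℝ A p w + deriv (deriv X) p.1 * w.1 * A p =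
      B (Φ p) * fderiv ℝ C p w + fderiv ℝ B (Φ p) (fderiv ℝ Φ p w) * C p := by
  have hX' : ContDiff ℝ (⊤ : ℕ∞) (deriv X) := by
    simpa using hX.iterate_deriv 1
  have e := congrArg (fun L : ℝ × ℝ × ℝ →L[ℝ] ℝ => L w) (Filter.EventuallyEq.fderiv_eq h)
  have l : fderiv ℝ (fun q => deriv X q.1 * A q) p = _ :=
    ((hasFDerivAt_comp_fst hX' p).fun_mul hA.hasFDerivAt).fderiv
  have hBΦ : HasFDerivAt (fun q => B (Φ q)) _ p := hB.hasFDerivAt.comp p hΦ.hasFDerivAt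
  have r : fderiv ℝ (fun q => B (Φ q) * C q) p = _ := (hBΦ.fun_mul hC.hasFDerivAt).fderiv
  rw [l, r] at e
  simp at e
  linarith

lemma fderiv_Prol_rel (hF : ContDiff ℝ (⊤ : ℕ∞) F) (hG : ContDiff ℝ (⊤ : ℕ∞) G)
    (hX : ContDiff ℝ (⊤ : ℕ∞) X) (hU : ContDiff ℝ (⊤ : ℕ∞) U) {p : ℝ × ℝ × ℝ}
    (h : ∀ᶠ q in nhds p, deriv X q.1 * G q = F (Prol X U G q)) (w : ℝ × ℝ × ℝ) :
    deriv X p.1 * fderiv ℝ G p w + deriv (deriv X) p.1 * w.1 * G p =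
      fderiv ℝ F (Prol X U G p) (fderiv ℝ (Prol X U G) p w) := by
  have e := fderiv_of_eventually_rel (C := fun _ => 1) hX (hG.differentiable (by simp) p)
    (hF.differentiable (by simp) _) (differentiableAt_const _)
    ((contDiff_Prol hX hU hG).differentiable (by simp) p) (by simpa using h) w
  simpa using e

lemma pd_du1_Prol_mul_Wfun (hF : ContDiff ℝ (⊤ : ℕ∞) F) (hG : ContDiff ℝ (⊤ : ℕ∞) G)
    (hX : ContDiff ℝ (⊤ : ℕ∞) X) (hU : ContDiff ℝ (⊤ : ℕ∞) U) {p : ℝ × ℝ × ℝ}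
    (h : ∀ᶠ q in nhds p, deriv X q.1 * G q = F (Prol X U G q)) :
    deriv X p.1 * pd G du1 p = pd F du1 (Prol X U G p) * Wfun U G p := by
  have e := fderiv_Prol_rel hF hG hX hU h du1
  rw [fderiv_Prol hX hU hG, fderiv_eq_pd, fderiv_eq_pd] at e
  unfold Wfun
  simp only [du1] at *
  linear_combination e

lemma fderiv_pd_du1_Prol_rel (hF : ContDiff ℝ (⊤ : ℕ∞) F) (hG : ContDiff ℝ (⊤ : ℕ∞) G)
    (hX : ContDiff ℝ (⊤ : ℕ∞) X) (hU : ContDiff ℝ (⊤ : ℕ∞) U) {p : ℝ × ℝ × ℝ}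
    (h : ∀ᶠ q in nhds p, deriv X q.1 * G q = F (Prol X U G q)) (w : ℝ × ℝ × ℝ) :
    deriv X p.1 * fderiv ℝ (pd G du1) p w + deriv (deriv X) p.1 * w.1 * pd G du1 p =
      pd F du1 (Prol X U G p) * fderiv ℝ (Wfun U G) p w +
        fderiv ℝ (pd F du1) (Prol X U G p) (fderiv ℝ (Prol X U G) p w) * Wfun U G p := by
  have hWs : ContDiff ℝ (⊤ : ℕ∞) (Wfun U G) := by
    have h1 := contDiff_Ux hU
    have h2 := contDiff_Uu hU
    have h3 := contDiff_pd hG du1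
    unfold Wfun
    fun_prop
  exact fderiv_of_eventually_rel hX (differentiableAt_pd hG du1 p)
    (differentiableAt_pd hF du1 _) (hWs.differentiable (by simp) p)
    ((contDiff_Prol hX hU hG).differentiable (by simp) p)
    (h.eventually_nhds.mono fun q hq => pd_du1_Prol_mul_Wfun hF hG hX hU hq) w

lemma fderiv_Prol_nabla1 (hF : ContDiff ℝ (⊤ : ℕ∞) F) (hG : ContDiff ℝ (⊤ : ℕ∞) G)
    (hX : ContDiff ℝ (⊤ : ℕ∞) X) (hU : ContDiff ℝ (⊤ : ℕ∞) U) {p : ℝ × ℝ × ℝ}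
    (h : ∀ᶠ q in nhds p, deriv X q.1 * G q = F (Prol X U G q))
    (hX' : deriv X p.1 ≠ 0) (hUu : Uu U (p.1, p.2.1) ≠ 0)
    (hG1 : pd G du1 p ≠ 0) (hW : Wfun U G p ≠ 0) :
    fderiv ℝ (Prol X U G) p (nabla1 G p) = nabla1 F (Prol X U G p) := by
  have e1 := pd_du1_Prol_mul_Wfun hF hG hX hU h
  have eu := fderiv_Prol_rel hF hG hX hU h du
  have e0 := h.self_of_nhds
  rw [fderiv_Prol hX hU hG] at eu ⊢
  have hP : (Prol X U G p).2.2 = Ux U (p.1, p.2.1) * G p + Uu U (p.1, p.2.1) * p.2.2 := rfl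
  rw [fderiv_eq_pd, fderiv_eq_pd] at eu
  simp only [du, mul_zero, zero_mul, one_mul, zero_add, add_zero] at eu
  simp only [nabla1, hP, ← e0]
  simp only [← show du = (0, 1, 0) from rfl] at eu
  have hWe : Uu U (p.1, p.2.1) = Wfun U G p - Ux U (p.1, p.2.1) * pd G du1 p := by
    unfold Wfun; ring
  generalize Wfun U G p = W at *
  generalize pd F du1 (Prol X U G p) = f1 at *
  generalize pd F du (Prol X U G p) = fu at *
  obtain rfl : f1 = deriv X p.1 * pd G du1 p / W := by
    rw [e1]; field_simp
  generalize Uu U (p.1, p.2.1) = q at *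
  obtain rfl : fu = (deriv X p.1 * pd G du p - deriv X p.1 * pd G du1 p / W *
      (Ux U (p.1, p.2.1) * pd G du p + Uu (Ux U) (p.1, p.2.1) * G p
        + Uu (Uu U) (p.1, p.2.1) * p.2.2)) / q := by
    rw [eq_div_iff hUu]; linear_combination -eu
  subst hWe
  ext
  · simp
  · dsimp only
    field_simp
    ring
  · dsimp only
    field_simp
    ring

/-- Where `(H - 1)·H_{xu₁} = 0`, the field `∇₃` agrees with its homogeneous form, which is
preserved by prolongations. -/
lemma fderiv_Prol_nabla3 (hF : ContDiff ℝ (⊤ : ℕ∞) F) (hG : ContDiff ℝ (⊤ : ℕ∞) G)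
    (hX : ContDiff ℝ (⊤ : ℕ∞) X) (hU : ContDiff ℝ (⊤ : ℕ∞) U) {p : ℝ × ℝ × ℝ}
    (h : ∀ᶠ q in nhds p, deriv X q.1 * G q = F (Prol X U G q))
    (hX' : deriv X p.1 ≠ 0) (hUu : Uu U (p.1, p.2.1) ≠ 0)
    (hG1 : pd G du1 p ≠ 0) (hG11 : pd (pd G du1) du1 p ≠ 0) (hW : Wfun U G p ≠ 0)
    (hGx1 : pd (pd G dx) du1 p = G p * pd (pd G dx) du1 p)
    (hFx1 : pd (pd F dx) du1 (Prol X U G p) =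
      F (Prol X U G p) * pd (pd F dx) du1 (Prol X U G p)) :
    fderiv ℝ (Prol X U G) p (nabla3 G p) = nabla3 F (Prol X U G p) := by
  have e0 := h.self_of_nhds
  have e1 := pd_du1_Prol_mul_Wfun hF hG hX hU h
  have eu := fderiv_Prol_rel hF hG hX hU h du
  have ex := fderiv_Prol_rel hF hG hX hU h dx
  have e11 := fderiv_pd_du1_Prol_rel hF hG hX hU h du1
  have eu1 := fderiv_pd_du1_Prol_rel hF hG hX hU h du
  have ex1 := fderiv_pd_du1_Prol_rel hF hG hX hU h dx
  have hP : (Prol X U G p).2.2 = Ux U (p.1, p.2.1) * G p + Uu U (p.1, p.2.1) * p.2.2 := rfl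
  have hWe : Uu U (p.1, p.2.1) = Wfun U G p - Ux U (p.1, p.2.1) * pd G du1 p := by
    unfold Wfun; ring
  simp only [fderiv_Wfun hU hG, fderiv_Prol hX hU hG, fderiv_eq_pd] at eu ex e11 eu1 ex1
  rw [fderiv_Prol hX hU hG]
  have x1 : dx.1 = 1 := rfl
  have x2 : dx.2.1 = 0 := rfl
  have x3 : dx.2.2 = 0 := rfl
  have u1 : du.1 = 0 := rfl
  have u2 : du.2.1 = 1 := rfl
  have u3 : du.2.2 = 0 := rfl
  have v1 : du1.1 = 0 := rfl
  have v2 : du1.2.1 = 0 := rfl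
  have v3 : du1.2.2 = 1 := rfl
  simp only [x1, x2, x3, u1, u2, u3, v1, v2, v3, mul_zero, zero_mul, one_mul, mul_one, zero_add,
    add_zero, pd_comm hG du1 dx, pd_comm hG du1 du, pd_comm hF du1 dx, pd_comm hF du1 du]
    at eu ex e11 eu1 ex1
  simp only [nabla3, hP]
  rw [hFx1, hGx1]
  simp only [← e0]
  clear hFx1 hGx1 h
  generalize F (Prol X U G p) = f0 at *
  generalize pd F du1 (Prol X U G p) = f1 at *
  generalize pd F du (Prol X U G p) = fu at *
  generalize pd F dx (Prol X U G p) = fx at *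
  generalize pd (pd F du1) du1 (Prol X U G p) = f11 at *
  generalize pd (pd F du) du1 (Prol X U G p) = fu1 at *
  generalize pd (pd F dx) du1 (Prol X U G p) = fx1 at *
  generalize Wfun U G p = W at *
  generalize Uu U (p.1, p.2.1) = q at *
  generalize deriv X p.1 = a at *
  generalize G p = g at *
  generalize pd G du1 p = g1 at *
  generalize pd (pd G du1) du1 p = g11 at *
  generalize pd G du p = gu at *
  generalize pd G dx p = gx at *
  generalize pd (pd G du) du1 p = gu1 at *
  generalize pd (pd G dx) du1 p = gx1 at *
  generalize deriv (deriv X) p.1 = b at *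
  generalize Ux U (p.1, p.2.1) = r at *
  generalize Ux (Ux U) (p.1, p.2.1) = rr at *
  generalize Uu (Ux U) (p.1, p.2.1) = rx at *
  generalize Uu (Uu U) (p.1, p.2.1) = ru at *
  have hf1 : f1 = a * g1 / W := by rw [e1]; field_simp
  have hf11 : f11 = a * g11 * q / W ^ 3 := by
    rw [eq_div_iff (pow_ne_zero 3 hW)]
    linear_combination -W * e11 - (f11 * W ^ 2 + a * g11) * hWe + r * g11 * e1
  have hfu : fu = (a * gu - (r * gu + rx * g + ru * p.2.2) * f1) / q := by
    rw [eq_div_iff hUu]; linear_combination -eu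
  have hfx : fx = (a * gx + b * g - r * fu - (r * gx + rr * g + rx * p.2.2) * f1) / a := by
    rw [eq_div_iff hX']; linear_combination -ex
  have hfu1 : fu1 = ((a * gu1 - f1 * (r * gu1 + rx * g1 + ru)) / W
      - (r * gu + rx * g + ru * p.2.2) * f11) / q := by
    field_simp; linear_combination -eu1
  have hfx1 : fx1 = ((a * gx1 + b * g1 - f1 * (r * gx1 + rr * g1 + rx)) / W
      - r * fu1 - (r * gx + rr * g + rx * p.2.2) * f11) / a := by
    field_simp; linear_combination -ex1
  have hr : r = (W - q) / g1 := by
    rw [hWe]; field_simp; ring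
  ext
  · simp
  · dsimp only
    rw [hf1, hr]
    field_simp
    ring
  · dsimp only
    rw [hfx1, hfx, hfu1, hfu, hf11, hf1, hr]
    field_simp
    ring

end Prolongation

lemma pd_dx_du1_eq_mul_of_lie {H : ℝ × ℝ × ℝ → ℝ} (hH : ContDiff ℝ (⊤ : ℕ∞) H) {p : ℝ × ℝ × ℝ}
    {k : ℝ} (h0 : H p ≠ 0) (h1 : pd H du1 p ≠ 0) (h11 : pd (pd H du1) du1 p ≠ 0)
    (h : lie (nabla3 H) (nabla1 H) p = k • nabla2 H p) :
    pd (pd H dx) du1 p = H p * pd (pd H dx) du1 p := by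
  have e := lie_nabla3_nabla1_snd_fst hH h1 h11
  rw [h] at e
  have hk : (k • nabla2 H p).2.1 = 0 := by simp [nabla2]
  rw [hk, eq_comm, mul_eq_zero] at e
  have := e.resolve_left (by positivity)
  linarith

/-- the third-order invariant `K` appearing in the commutation
relation `[∇₃, ∇₁] = K·∇₂` is a feedback differential invariant: with `(X,U)`
relating `G` to `F` on `D_G`, `W ≠ 0` on `D_G`, the regularity conditions on
`G` (on `D_G`) and on `F` (on an open `D_F ⊇ Φ̃(D_G)`), and smooth `K_F`, `K_G`
satisfying the commutation relations, we have `K_F(Φ̃(p)) = K_G(p)` on `D_G`. -/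
theorem K_is_feedback_invariant
    (F G : ℝ × ℝ × ℝ → ℝ) (X : ℝ → ℝ) (U : ℝ × ℝ → ℝ)
    (hF : ContDiff ℝ (⊤ : ℕ∞) F) (hG : ContDiff ℝ (⊤ : ℕ∞) G)
    (hX : ContDiff ℝ (⊤ : ℕ∞) X) (hU : ContDiff ℝ (⊤ : ℕ∞) U)
    (hX' : ∀ x, deriv X x ≠ 0) (hUu : ∀ q, Uu U q ≠ 0)
    (DG DF : Set (ℝ × ℝ × ℝ)) (hDG : IsOpen DG) (hDF : IsOpen DF)
    (hrel : Relates X U G F DG)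
    (hW : ∀ p ∈ DG, Wfun U G p ≠ 0)
    (hG0 : ∀ p ∈ DG, G p ≠ 0)
    (hG1 : ∀ p ∈ DG, pd G du1 p ≠ 0)
    (hG2 : ∀ p ∈ DG, pd (pd G du1) du1 p ≠ 0)
    (himg : ∀ p ∈ DG, Prol X U G p ∈ DF)
    (hF0 : ∀ q ∈ DF, F q ≠ 0)
    (hF1 : ∀ q ∈ DF, pd F du1 q ≠ 0)
    (hF2 : ∀ q ∈ DF, pd (pd F du1) du1 q ≠ 0)
    (KF KG : ℝ × ℝ × ℝ → ℝ)
    (hKF : ContDiffOn ℝ (⊤ : ℕ∞) KF DF) (hKG : ContDiffOn ℝ (⊤ : ℕ∞) KG DG)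
    (hcommF : ∀ q ∈ DF, lie (nabla3 F) (nabla1 F) q = KF q • nabla2 F q)
    (hcommG : ∀ p ∈ DG, lie (nabla3 G) (nabla1 G) p = KG p • nabla2 G p) :
    ∀ p ∈ DG, KF (Prol X U G p) = KG p := by
  intro p hp
  have hrel' : ∀ q ∈ DG, ∀ᶠ z in nhds q, deriv X z.1 * G z = F (Prol X U G z) := fun q hq =>
    (hDG.eventually_mem hq).mono hrel
  have r1 : ∀ q ∈ DG, fderiv ℝ (Prol X U G) q (nabla1 G q) = nabla1 F (Prol X U G q) :=
    fun q hq => fderiv_Prol_nabla1 hF hG hX hU (hrel' q hq) (hX' _) (hUu _) (hG1 q hq) (hW q hq)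
  have r3 : ∀ q ∈ DG, fderiv ℝ (Prol X U G) q (nabla3 G q) = nabla3 F (Prol X U G q) :=
    fun q hq => fderiv_Prol_nabla3 hF hG hX hU (hrel' q hq) (hX' _) (hUu _) (hG1 q hq)
      (hG2 q hq) (hW q hq)
      (pd_dx_du1_eq_mul_of_lie hG (hG0 q hq) (hG1 q hq) (hG2 q hq) (hcommG q hq))
      (pd_dx_du1_eq_mul_of_lie hF (hF0 _ (himg q hq)) (hF1 _ (himg q hq)) (hF2 _ (himg q hq))
        (hcommF _ (himg q hq)))
  have hpF := himg p hp
  have key := fderiv_lie_of_related (contDiff_Prol hX hU hG)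
    (differentiableAt_nabla3 hG (hG1 p hp) (hG2 p hp)) (differentiableAt_nabla1 hG (hG1 p hp))
    (differentiableAt_nabla3 hF (hF1 _ hpF) (hF2 _ hpF)) (differentiableAt_nabla1 hF (hF1 _ hpF))
    ((hDG.eventually_mem hp).mono r3) ((hDG.eventually_mem hp).mono r1)
  have e0 : deriv X p.1 * G p = F (Prol X U G p) := hrel p hp
  have e1 := pd_du1_Prol_mul_Wfun hF hG hX hU (hrel' p hp)
  have r2 : fderiv ℝ (Prol X U G) p (nabla2 G p) = nabla2 F (Prol X U G p) := by
    have hf1 := hF1 _ hpF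
    have hg1 := hG1 p hp
    rw [fderiv_Prol hX hU hG]
    simp only [nabla2, ← e0]
    ext
    · simp
    · simp
    · dsimp only
      rw [eq_div_iff hf1]
      simp only [zero_mul, zero_add, add_zero]
      field_simp
      unfold Wfun at e1
      linear_combination -G p * e1
  rw [hcommG p hp, hcommF _ hpF, map_smul, r2] at key
  refine (smul_left_injective ℝ (fun h => ?_) key).symm
  exact div_ne_zero (hF0 _ hpF) (hF1 _ hpF) (congrArg (fun v => v.2.2) h)
end
end
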